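/- Let (Z,W) be a jointly Gaussian random vector with Z taking values in ℝ^k and W in ℝ^l. Suppose there exist an ℕ-valued random variable V with finite Shannon entropy and a measurable function g : ℕ × ℝ^l → ℝ^k such that Z = g(V,W) almost surely. Then there exist a matrix B ∈ ℝ^{k×l} and a vector c ∈ ℝ^k such that Z = B·W + c almost surely. -/

import Mathlib

noncomputable section

open MeasureTheory ProbabilityTheory

/-- A random vector is (jointly) Gaussian if every linear functional of it has a
(possibly degenerate) Gaussian distribution on `ℝ`. -/
def IsGaussianVec {Ω : Type*} [MeasurableSpace Ω] (P : Measure Ω) {ι : Type*} [Fintype ι]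
    (Z : Ω → ι → ℝ) : Prop :=
  ∀ a : ι → ℝ, ∃ (m : ℝ) (v : NNReal),
    P.map (fun ω => ∑ i, a i * Z ω i) = gaussianReal m v

/-- Finite Shannon entropy of an `ℕ`-valued random variable. -/
def HasFiniteEntropy {Ω : Type*} [MeasurableSpace Ω] (P : Measure Ω) (V : Ω → ℕ) : Prop :=
  Summable fun n => Real.negMulLog (P (V ⁻¹' {n})).toReal

theorem IsGaussianVec.hasGaussianLaw {Ω : Type*} [MeasurableSpace Ω] {P : Measure Ω}
    {ι : Type*} [Fintype ι] {X : Ω → ι → ℝ} (hX : Measurable X) (h : IsGaussianVec P X) :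
    HasGaussianLaw X P where
  isGaussian_map := by
    refine isGaussian_of_map_eq_gaussianReal fun L => ?_
    classical
    obtain ⟨m, v, hmv⟩ := h fun i => L (Pi.single i 1)
    refine ⟨m, v, ?_⟩
    rw [Measure.map_map (by fun_prop) hX, ← hmv]
    congr 1
    ext ω
    refine (L.toLinearMap.pi_apply_eq_sum_univ (X ω)).trans (Finset.sum_congr rfl fun i _ => ?_)
    have hi : (fun j => if i = j then (1 : ℝ) else 0) = Pi.single i 1 := by
      ext j
      simp [Pi.single_apply, eq_comm]
    rw [hi, smul_eq_mul, mul_comm, ContinuousLinearMap.coe_coe]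

/-- The covariance as an inner product in `L²`. -/
theorem covariance_eq_inner_toLp {Ω : Type*} [MeasurableSpace Ω] {P : Measure Ω}
    [IsProbabilityMeasure P] {X Y : Ω → ℝ} (hX : MemLp X 2 P) (hY : MemLp Y 2 P) :
    cov[X, Y; P] = inner ℝ ((hX.sub (memLp_const P[X])).toLp _)
      ((hY.sub (memLp_const P[Y])).toLp _) := by
  rw [L2.inner_def, covariance]
  refine integral_congr_ae ?_
  filter_upwards [(hX.sub (memLp_const P[X])).coeFn_toLp,
    (hY.sub (memLp_const P[Y])).coeFn_toLp] with ω h1 h2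
  rw [h1, h2]
  simp [mul_comm]

/-- Linear regression: the residual of the best linear predictor of `X` is uncorrelated with the
predictors. -/
theorem exists_covariance_sub_sum_eq_zero {Ω : Type*} [MeasurableSpace Ω] {P : Measure Ω}
    [IsProbabilityMeasure P] {ι : Type*} [Fintype ι] {X : Ω → ℝ} {Y : ι → Ω → ℝ}
    (hX : MemLp X 2 P) (hY : ∀ i, MemLp (Y i) 2 P) :
    ∃ b : ι → ℝ, ∀ j, cov[fun ω => X ω - ∑ i, b i * Y i ω, Y j; P] = 0 := by
  let x := (hX.sub (memLp_const P[X])).toLp _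
  let y (i : ι) := ((hY i).sub (memLp_const P[Y i])).toLp _
  have : FiniteDimensional ℝ (Submodule.span ℝ (Set.range y)) :=
    FiniteDimensional.span_of_finite ℝ (Set.finite_range y)
  obtain ⟨u, hu, r, hr, hxr⟩ := (Submodule.span ℝ (Set.range y)).exists_add_mem_mem_orthogonal x
  obtain ⟨b, rfl⟩ := (Submodule.mem_span_range_iff_exists_fun ℝ).1 hu
  refine ⟨b, fun j => ?_⟩
  rw [covariance_fun_sub_left hX (memLp_finsetSum _ fun i _ => (hY i).const_mul _) (hY j),
    covariance_fun_sum_left (fun i => (hY i).const_mul _) (hY j)]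
  simp_rw [covariance_const_mul_left, covariance_eq_inner_toLp (hY _) (hY j)]
  rw [covariance_eq_inner_toLp hX (hY j)]
  change inner ℝ x (y j) - ∑ i, b i * inner ℝ (y i) (y j) = 0
  have hj : inner ℝ r (y j) = 0 :=
    (Submodule.mem_orthogonal' _ _).1 hr _ (Submodule.subset_span ⟨j, rfl⟩)
  rw [hxr, inner_add_left, hj, sum_inner]
  simp [real_inner_smul_left]

/-- A real random variable with a diffuse law cannot be a function of an independent random
variable together with a countable one. -/
theorem not_ae_eq_of_indepFun_of_countable {Ω E N : Type*} [MeasurableSpace Ω]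
    [MeasurableSpace E] [Countable N] {P : Measure Ω} [IsProbabilityMeasure P]
    {R : Ω → ℝ} {W : Ω → E} (hR : AEMeasurable R P) (hW : AEMeasurable W P) (hRW : IndepFun W R P)
    [NullSingletonClass (P.map R)] (V : Ω → N) {h : N → E → ℝ} (hh : ∀ n, Measurable (h n)) :
    ¬ ∀ᵐ ω ∂P, R ω = h (V ω) (W ω) := by
  intro hae
  have hn (n : N) : ∀ᵐ ω ∂P, R ω ≠ h n (W ω) := by
    have hs : MeasurableSet {p : E × ℝ | p.2 ≠ h n p.1} :=
      (measurableSet_eq_fun measurable_snd ((hh n).comp measurable_fst)).compl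
    have hp : ∀ᵐ p ∂(P.map fun ω => (W ω, R ω)), p.2 ≠ h n p.1 := by
      rw [(indepFun_iff_map_prod_eq_prod_map_map hW hR).1 hRW, Measure.ae_prod_iff_ae_ae hs]
      refine Filter.Eventually.of_forall fun w => ?_
      simp [ae_iff]
    exact (ae_map_iff (hW.prodMk hR) hs).1 hp
  obtain ⟨ω, h1, h2⟩ := (hae.and (ae_all_iff.2 hn)).exists
  exact h2 _ h1

/-- A Gaussian random variable that is a function of an independent random variable together with
a countable one is almost surely constant. -/
theorem ProbabilityTheory.HasGaussianLaw.exists_ae_eq_const_of_indepFun {Ω E N : Type*} [MeasurableSpace Ω]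
    [MeasurableSpace E] [Countable N] {P : Measure Ω} [IsProbabilityMeasure P]
    {R : Ω → ℝ} {W : Ω → E} (hR : HasGaussianLaw R P) (hW : AEMeasurable W P)
    (hRW : IndepFun W R P) (V : Ω → N) {h : N → E → ℝ} (hh : ∀ n, Measurable (h n))
    (hae : ∀ᵐ ω ∂P, R ω = h (V ω) (W ω)) :
    ∃ c : ℝ, ∀ᵐ ω ∂P, R ω = c := by
  by_cases hv : Var[R; P].toNNReal = 0
  · refine ⟨P[R], ae_of_ae_map (p := fun x => x = P[R]) hR.aemeasurable ?_⟩
    rw [hR.map_eq_gaussianReal, hv, gaussianReal_zero_var]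
    simp [ae_dirac_eq]
  · have : NullSingletonClass (P.map R) := by
      rw [hR.map_eq_gaussianReal]
      exact nullSingletonClass_gaussianReal hv
    exact absurd hae (not_ae_eq_of_indepFun_of_countable hR.aemeasurable hW hRW V hh)

/-- **Second key intermediate claim of Lemma 6 of the paper**: if `(Z, W)` is jointly
Gaussian and `Z = g(V, W)` a.s. for some `ℕ`-valued `V` of finite Shannon entropy and
measurable `g`, then `Z` is almost surely an affine function of `W`. -/
theorem stmt16 {Ω : Type*} [MeasurableSpace Ω] (P : Measure Ω) [IsProbabilityMeasure P]
    {k l : ℕ} (Z : Ω → Fin k → ℝ) (W : Ω → Fin l → ℝ)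
    (hZ : Measurable Z) (hW : Measurable W)
    (hGauss : IsGaussianVec P fun ω => Sum.elim (Z ω) (W ω))
    (V : Ω → ℕ) (hV : Measurable V) (hVent : HasFiniteEntropy P V)
    (g : ℕ × (Fin l → ℝ) → Fin k → ℝ) (hg : Measurable g)
    (hZg : (fun ω => Z ω) =ᵐ[P] fun ω => g (V ω, W ω)) :
    ∃ (B : Matrix (Fin k) (Fin l) ℝ) (c : Fin k → ℝ),
      (fun ω => Z ω) =ᵐ[P] fun ω => B.mulVec (W ω) + c := by
  have hXm : Measurable fun ω => Sum.elim (Z ω) (W ω) :=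
    measurable_pi_iff.2 fun s => by cases s <;> simp <;> fun_prop
  have hX := hGauss.hasGaussianLaw hXm
  have hZ2 (i : Fin k) : MemLp (fun ω => Z ω i) 2 P := (hX.eval (Sum.inl i)).memLp_two
  have hW2 (j : Fin l) : MemLp (fun ω => W ω j) 2 P := (hX.eval (Sum.inr j)).memLp_two
  have key (i : Fin k) :
      ∃ (b : Fin l → ℝ) (c : ℝ), ∀ᵐ ω ∂P, Z ω i - ∑ j, b j * W ω j = c := by
    obtain ⟨b, hb⟩ := exists_covariance_sub_sum_eq_zero (hZ2 i) hW2
    let L : (Fin k ⊕ Fin l → ℝ) →L[ℝ] (Fin l → ℝ) × (Unit → ℝ) :=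
      (ContinuousLinearMap.pi fun j => .proj (Sum.inr j)).prod
        (.pi fun _ => .proj (Sum.inl i) - ∑ j, b j • .proj (Sum.inr j))
    have hL : HasGaussianLaw
        (fun ω => (fun j => W ω j, fun _ : Unit => Z ω i - ∑ j, b j * W ω j)) P := by
      refine (hX.map_fun L).congr (.of_forall fun ω => ?_)
      ext <;> simp [L]
    have hind := hL.indepFun_of_covariance_eval (X := fun j ω => W ω j)
      (Y := fun _ ω => Z ω i - ∑ j, b j * W ω j)
      fun j _ => by rw [covariance_comm]; exact hb j
    refine ⟨b, (hL.snd.eval ()).exists_ae_eq_const_of_indepFun hW.aemeasurable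
      (hind.comp measurable_id (measurable_pi_apply ())) V
      (h := fun n w => g (n, w) i - ∑ j, b j * w j) (fun n => by fun_prop) ?_⟩
    filter_upwards [hZg] with ω hω
    rw [hω]
  choose B c hBc using key
  refine ⟨Matrix.of B, c, ?_⟩
  filter_upwards [ae_all_iff.2 hBc] with ω hω
  ext i
  simp [Matrix.mulVec, dotProduct, ← hω i]

end
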